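/- arXiv:2004.05132 — 17 statements merged into one kernel-verified Lean document; each statement's English description precedes it below -/
import Mathlib

section
/- Let z ∈ ℝⁿ and τ, λ > 0. A point w ∈ ℝⁿ is a minimizer of the function z' ↦ (1/2)‖z' − z‖² + τλ‖z'‖₀ if and only if for every index i ∈ {1,…,n}: w_i = z_i when |z_i| > √(2τλ); w_i ∈ {z_i, 0} when |z_i| = √(2τλ); and w_i = 0 when |z_i| < √(2τλ). -/
open scoped RealInnerProductSpace

/-- The ℓ₀ "norm": number of nonzero entries of `x`. -/
noncomputable def norm0 {n : ℕ} (x : EuclideanSpace ℝ (Fin n)) : ℕ :=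
  (Finset.univ.filter fun i => x i ≠ 0).card

/-- `proxL0 c z` is the set of minimizers of `z' ↦ (1/2)‖z' - z‖² + c ‖z'‖₀`. -/
def proxL0 {n : ℕ} (c : ℝ) (z : EuclideanSpace ℝ (Fin n)) :
    Set (EuclideanSpace ℝ (Fin n)) :=
  {w | ∀ u : EuclideanSpace ℝ (Fin n),
    (1:ℝ)/2 * ‖w - z‖^2 + c * (norm0 w : ℝ) ≤ (1:ℝ)/2 * ‖u - z‖^2 + c * (norm0 u : ℝ)}

/-- `x` is a `τ`-stationary point of `min f(x) + λ‖x‖₀`. -/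
def IsTauStationary {n : ℕ} (f : EuclideanSpace ℝ (Fin n) → ℝ) (lam τ : ℝ)
    (x : EuclideanSpace ℝ (Fin n)) : Prop :=
  x ∈ proxL0 (τ * lam) (x - τ • gradient f x)

/-- The objective of `proxL0` splits as a sum over coordinates. -/
theorem proxL0_objective_eq_sum {n : ℕ} (c : ℝ) (z u : EuclideanSpace ℝ (Fin n)) :
    (1:ℝ)/2 * ‖u - z‖^2 + c * (norm0 u : ℝ) =
      ∑ i, ((1:ℝ)/2 * (u i - z i)^2 + if u i = 0 then 0 else c) := by
  rw [EuclideanSpace.real_norm_sq_eq, Finset.sum_add_distrib, Finset.mul_sum, norm0,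
    Finset.card_filter, Nat.cast_sum, Finset.mul_sum]
  congr 1
  refine Finset.sum_congr rfl fun i _ => ?_
  by_cases h : u i = 0 <;> simp [h]

/-- A separable function is minimized exactly when each summand is. -/
theorem forall_sum_le_sum_iff {ι α : Type*} [Fintype ι] (g : ι → α → ℝ) (w : ι → α) :
    (∀ u : ι → α, ∑ i, g i (w i) ≤ ∑ i, g i (u i)) ↔ ∀ i t, g i (w i) ≤ g i t := by
  classical
  refine ⟨fun h i t => ?_, fun h u => Finset.sum_le_sum fun i _ => h i (u i)⟩
  have hu := h (Function.update w i t)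
  rw [← Finset.add_sum_erase _ _ (Finset.mem_univ i),
    ← Finset.add_sum_erase _ (fun j => g j (Function.update w i t j)) (Finset.mem_univ i)] at hu
  have hrest : ∑ j ∈ Finset.univ.erase i, g j (Function.update w i t j) =
      ∑ j ∈ Finset.univ.erase i, g j (w j) :=
    Finset.sum_congr rfl fun j hj => by
      rw [Function.update_of_ne (Finset.ne_of_mem_erase hj)]
  simp only [hrest, Function.update_self] at hu
  linarith

/-- Minimizers of the scalar problem `t ↦ (1/2)(t - b)² + c · 1_{t ≠ 0}`. -/
theorem scalar_prox_l0_iff {c : ℝ} (hc : 0 < c) (a b : ℝ) :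
    (∀ t : ℝ, (1:ℝ)/2 * (a - b)^2 + (if a = 0 then 0 else c) ≤
        (1:ℝ)/2 * (t - b)^2 + if t = 0 then 0 else c) ↔
      (|b| > Real.sqrt (2 * c) → a = b) ∧
      (|b| = Real.sqrt (2 * c) → a = b ∨ a = 0) ∧
      (|b| < Real.sqrt (2 * c) → a = 0) := by
  have hgt : |b| > Real.sqrt (2 * c) ↔ 2 * c < b ^ 2 := by
    rw [gt_iff_lt, ← Real.sqrt_sq_eq_abs, Real.sqrt_lt_sqrt_iff (by positivity)]
  have hlt : |b| < Real.sqrt (2 * c) ↔ b ^ 2 < 2 * c := by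
    rw [Real.lt_sqrt (abs_nonneg b), sq_abs]
  have heq : |b| = Real.sqrt (2 * c) ↔ b ^ 2 = 2 * c := by
    rw [eq_comm, Real.sqrt_eq_iff_eq_sq (by positivity) (abs_nonneg b), sq_abs, eq_comm]
  rw [hgt, hlt, heq]
  constructor
  · intro h
    have h0 := h 0
    have hb := h b
    simp only [if_true, sub_self] at h0 hb
    by_cases ha : a = 0
    · subst ha
      refine ⟨fun hz => ?_, fun _ => Or.inr rfl, fun _ => rfl⟩
      split_ifs at hb <;> nlinarith
    · have hab : a = b := by
        rw [if_neg ha] at hb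
        have : (a - b) ^ 2 = 0 := by
          split_ifs at hb <;> nlinarith [sq_nonneg (a - b)]
        exact sub_eq_zero.mp (pow_eq_zero_iff two_ne_zero |>.mp this)
      refine ⟨fun _ => hab, fun _ => Or.inl hab, fun hz => ?_⟩
      rw [if_neg ha] at h0
      nlinarith [sq_nonneg (a - b)]
  · rintro ⟨h1, h2, h3⟩ t
    have key : (a = b ∧ 2 * c ≤ b ^ 2) ∨ (a = 0 ∧ b ^ 2 ≤ 2 * c) := by
      rcases lt_trichotomy (b ^ 2) (2 * c) with h | h | h
      · exact Or.inr ⟨h3 h, h.le⟩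
      · exact (h2 h).imp (fun e => ⟨e, h.ge⟩) fun e => ⟨e, h.le⟩
      · exact Or.inl ⟨h1 h, h.le⟩
    rcases key with ⟨rfl, h⟩ | ⟨rfl, h⟩
    · have ha : a ≠ 0 := by rintro rfl; linarith
      rw [if_neg ha]
      split_ifs with ht
      · subst ht; nlinarith
      · nlinarith [sq_nonneg (t - a)]
    · rw [if_pos rfl]
      split_ifs with ht
      · rw [ht]
      · nlinarith [sq_nonneg (t - b)]

/-- closed form of the proximal operator of `τλ‖·‖₀`. -/
theorem prox_l0_mem_iff {n : ℕ} (τ lam : ℝ) (hτ : 0 < τ) (hlam : 0 < lam)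
    (z w : EuclideanSpace ℝ (Fin n)) :
    w ∈ proxL0 (τ * lam) z ↔
      ∀ i : Fin n,
        (|z i| > Real.sqrt (2 * τ * lam) → w i = z i) ∧
        (|z i| = Real.sqrt (2 * τ * lam) → w i = z i ∨ w i = 0) ∧
        (|z i| < Real.sqrt (2 * τ * lam) → w i = 0) := by
  have hsep := forall_sum_le_sum_iff
    (fun i t => (1:ℝ)/2 * (t - z i)^2 + if t = 0 then 0 else τ * lam) (fun i => w i)
  simp only [mul_assoc, ← scalar_prox_l0_iff (mul_pos hτ hlam)]
  rw [← hsep]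
  simp only [proxL0, Set.mem_ofPred_eq, proxL0_objective_eq_sum]
  exact ⟨fun h u => h (WithLp.toLp 2 u), fun h u => h u⟩
end

section
/- Let f: ℝⁿ → ℝ be continuously differentiable and τ, λ > 0. A point x ∈ ℝⁿ is a τ-stationary point of the problem min_{x∈ℝⁿ} f(x) + λ‖x‖₀ if and only if: for every i with x_i ≠ 0, ∇_i f(x) = 0 and |x_i| ≥ √(2τλ), and for every i with x_i = 0, |∇_i f(x)| ≤ √(2λ/τ). -/
open scoped RealInnerProductSpace

/-- The separable part of the objective defining `proxL0`, in one coordinate. -/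
noncomputable def proxCost (c a t : ℝ) : ℝ :=
  (1:ℝ)/2 * (t - a)^2 + c * (if t ≠ 0 then 1 else 0)

lemma prox_objective_eq_sum {n : ℕ} (c : ℝ) (z u : EuclideanSpace ℝ (Fin n)) :
    (1:ℝ)/2 * ‖u - z‖^2 + c * (norm0 u : ℝ) = ∑ i, proxCost c (z i) (u i) := by
  simp [proxCost, norm0, EuclideanSpace.real_norm_sq_eq, Finset.sum_add_distrib,
    Finset.mul_sum, Finset.card_filter]

lemma mem_proxL0_iff {n : ℕ} (c : ℝ) (z w : EuclideanSpace ℝ (Fin n)) :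
    w ∈ proxL0 c z ↔ ∀ i, ∀ t, proxCost c (z i) (w i) ≤ proxCost c (z i) t := by
  simp only [proxL0, Set.mem_ofPred_eq, prox_objective_eq_sum]
  refine ⟨fun h i t => ?_, fun h u => Finset.sum_le_sum fun i _ => h i (u i)⟩
  have key := h (WithLp.toLp 2 (Function.update (⇑w) i t))
  rw [← Finset.add_sum_erase _ _ (Finset.mem_univ i),
    ← Finset.add_sum_erase _ _ (Finset.mem_univ i)] at key
  have rest : ∑ j ∈ Finset.univ.erase i, proxCost c (z j) (Function.update (⇑w) i t j)
      = ∑ j ∈ Finset.univ.erase i, proxCost c (z j) (w j) :=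
    Finset.sum_congr rfl fun j hj => by
      rw [Function.update_of_ne (Finset.ne_of_mem_erase hj)]
  simp only [Function.update_self, rest] at key
  linarith

lemma proxCost_minimal_iff_of_ne_zero {c a w : ℝ} (hc : 0 < c) (hw : w ≠ 0) :
    (∀ t, proxCost c a w ≤ proxCost c a t) ↔ a = w ∧ 2 * c ≤ w^2 := by
  constructor
  · intro h
    have h0 := h 0
    have ha := h a
    simp only [proxCost, hw, ne_eq, not_false_eq_true, not_true_eq_false, if_true,
      if_false] at h0 ha
    have haw : a = w := by
      split_ifs at ha with ha0
      · subst ha0; nlinarith [sq_nonneg w]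
      · have : (w - a)^2 = 0 := by nlinarith [sq_nonneg (w - a)]
        linarith [pow_eq_zero_iff (two_ne_zero) |>.mp this]
    subst haw
    exact ⟨rfl, by nlinarith⟩
  · rintro ⟨rfl, h⟩ t
    by_cases ht : t = 0
    · simp only [proxCost, hw, ht, ne_eq, not_false_eq_true, not_true_eq_false, if_true, if_false]
      nlinarith
    · simp only [proxCost, hw, ht, ne_eq, not_false_eq_true, if_true]
      nlinarith [sq_nonneg (t - a)]

lemma proxCost_minimal_zero_iff {c a : ℝ} (hc : 0 < c) :
    (∀ t, proxCost c a 0 ≤ proxCost c a t) ↔ a^2 ≤ 2 * c := by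
  constructor
  · intro h
    have ha := h a
    simp only [proxCost, ne_eq, not_true_eq_false, if_false] at ha
    split_ifs at ha <;> nlinarith
  · intro h t
    by_cases ht : t = 0
    · rw [ht]
    · simp only [proxCost, ht, ne_eq, not_false_eq_true, not_true_eq_false, if_true, if_false]
      nlinarith [sq_nonneg (t - a)]

/-- characterization of τ-stationary points (Lemma 2.1). -/
theorem tau_stationary_iff {n : ℕ} (f : EuclideanSpace ℝ (Fin n) → ℝ)
    (hf : ContDiff ℝ 1 f) (τ lam : ℝ) (hτ : 0 < τ) (hlam : 0 < lam)
    (x : EuclideanSpace ℝ (Fin n)) :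
    IsTauStationary f lam τ x ↔
      ((∀ i, x i ≠ 0 → gradient f x i = 0 ∧ Real.sqrt (2 * τ * lam) ≤ |x i|) ∧
       (∀ i, x i = 0 → |gradient f x i| ≤ Real.sqrt (2 * lam / τ))) := by
  have hc : 0 < τ * lam := mul_pos hτ hlam
  have hsupp : ∀ i, x i ≠ 0 →
      ((∀ t, proxCost (τ * lam) ((x - τ • gradient f x) i) (x i)
          ≤ proxCost (τ * lam) ((x - τ • gradient f x) i) t) ↔
        gradient f x i = 0 ∧ Real.sqrt (2 * τ * lam) ≤ |x i|) := fun i hi => by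
    rw [proxCost_minimal_iff_of_ne_zero hc hi, Real.sqrt_le_left (abs_nonneg _), sq_abs,
      ← mul_assoc]
    simp [hτ.ne']
  have hzero : ∀ i, x i = 0 →
      ((∀ t, proxCost (τ * lam) ((x - τ • gradient f x) i) (x i)
          ≤ proxCost (τ * lam) ((x - τ • gradient f x) i) t) ↔
        |gradient f x i| ≤ Real.sqrt (2 * lam / τ)) := fun i hi => by
    rw [hi, proxCost_minimal_zero_iff hc, Real.le_sqrt (abs_nonneg _) (by positivity), sq_abs,
      le_div_iff₀ hτ]
    simp only [PiLp.sub_apply, PiLp.smul_apply, smul_eq_mul, hi, zero_sub, neg_sq]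
    rw [← mul_le_mul_iff_right₀ (b := gradient f x i ^ 2 * τ) hτ]
    ring_nf
  rw [IsTauStationary, mem_proxL0_iff]
  constructor
  · exact fun h => ⟨fun i hi => (hsupp i hi).mp (h i), fun i hi => (hzero i hi).mp (h i)⟩
  · rintro ⟨h₁, h₂⟩ i
    by_cases hi : x i = 0
    · exact (hzero i hi).mpr (h₂ i hi)
    · exact (hsupp i hi).mpr (h₁ i hi)
end

section
/- Let f: ℝⁿ → ℝ be continuously differentiable and λ > 0. If x ∈ ℝⁿ is a τ-stationary point of the problem min_{x∈ℝⁿ} f(x) + λ‖x‖₀ for some τ > 0, then for every τ₁ with 0 < τ₁ ≤ τ, x is also a τ₁-stationary point of the same problem. -/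
open scoped RealInnerProductSpace

/-- Expanding the square, membership of `x` in the proximal set at `x - τ • g` is the
nonnegativity of a quadratic model of the increment. -/
theorem mem_proxL0_sub_smul_iff {n : ℕ} {c τ : ℝ} {x g : EuclideanSpace ℝ (Fin n)} :
    x ∈ proxL0 c (x - τ • g) ↔ ∀ u : EuclideanSpace ℝ (Fin n),
      0 ≤ (1:ℝ)/2 * ‖u - x‖^2 + τ * ⟪u - x, g⟫ + c * ((norm0 u : ℝ) - norm0 x) := by
  refine forall_congr' fun u => ?_
  have hu : ‖u - (x - τ • g)‖^2 = ‖u - x‖^2 + 2 * (τ * ⟪u - x, g⟫) + ‖τ • g‖^2 := by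
    rw [← sub_add, norm_add_sq_real, real_inner_smul_right]
  rw [hu, sub_sub_cancel]
  constructor <;> intro h <;> linarith

/-- a τ-stationary point is a τ₁-stationary point for any 0 < τ₁ ≤ τ. -/
theorem tau_stationary_mono {n : ℕ} (f : EuclideanSpace ℝ (Fin n) → ℝ)
    (hf : ContDiff ℝ 1 f) (lam : ℝ) (hlam : 0 < lam)
    (x : EuclideanSpace ℝ (Fin n)) (τ : ℝ) (hτ : 0 < τ)
    (hx : IsTauStationary f lam τ x) :
    ∀ τ₁ : ℝ, 0 < τ₁ → τ₁ ≤ τ → IsTauStationary f lam τ₁ x := by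
  intro τ₁ hτ₁ hle
  rw [IsTauStationary, mem_proxL0_sub_smul_iff] at hx ⊢
  intro u
  refine nonneg_of_mul_nonneg_right ?_ hτ
  have h₁ := mul_nonneg hτ₁.le (hx u)
  have h₂ := mul_nonneg (sub_nonneg.2 hle) (sq_nonneg ‖u - x‖)
  linarith
end

section
/- Let f: ℝⁿ → ℝ be continuously differentiable and strongly smooth with constant L > 0, let λ > 0, and let 0 < τ < 1/L. If x* is a global minimizer of f(x) + λ‖x‖₀ over ℝⁿ, then the set Prox_{τλ‖·‖₀}(x* − τ∇f(x*)) equals the singleton {x*}; in particular x* is a τ-stationary point. -/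
open scoped RealInnerProductSpace

/-- The prox objective centred at `x - τ • g`, expanded around `x`. -/
theorem half_norm_sub_sub_smul_sq {E : Type*} [NormedAddCommGroup E] [InnerProductSpace ℝ E]
    (x g u : E) (τ : ℝ) :
    (1:ℝ)/2 * ‖u - (x - τ • g)‖^2 =
      (1:ℝ)/2 * ‖u - x‖^2 + τ * ⟪g, u - x⟫ + (1:ℝ)/2 * ‖x - (x - τ • g)‖^2 := by
  have h : u - (x - τ • g) = (u - x) + τ • g := by abel
  rw [h, sub_sub_cancel, norm_add_sq_real, real_inner_smul_right, real_inner_comm]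
  ring

/-- a global minimizer of `f + λ‖·‖₀` is a τ-stationary point for
`0 < τ < 1/L`, and the prox set is the singleton `{x*}` (Theorem 2.1, part 1). -/
theorem global_minimizer_is_tau_stationary {n : ℕ}
    (f : EuclideanSpace ℝ (Fin n) → ℝ) (hf : ContDiff ℝ 1 f)
    (L : ℝ) (hL : 0 < L)
    (hsmooth : ∀ x z : EuclideanSpace ℝ (Fin n),
      f z ≤ f x + ⟪gradient f x, z - x⟫ + L / 2 * ‖z - x‖ ^ 2)
    (lam τ : ℝ) (hlam : 0 < lam) (hτ0 : 0 < τ) (hτ : τ < 1 / L)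
    (xs : EuclideanSpace ℝ (Fin n))
    (hmin : ∀ x : EuclideanSpace ℝ (Fin n),
      f xs + lam * (norm0 xs : ℝ) ≤ f x + lam * (norm0 x : ℝ)) :
    proxL0 (τ * lam) (xs - τ • gradient f xs) = {xs} ∧
      IsTauStationary f lam τ xs := by
  have hτL : 0 < 1 - τ * L := by
    have := (lt_div_iff₀ hL).1 hτ
    linarith
  have hgrowth : ∀ u : EuclideanSpace ℝ (Fin n),
      (1:ℝ)/2 * ‖xs - (xs - τ • gradient f xs)‖^2 + τ * lam * (norm0 xs : ℝ)
        + (1 - τ * L) / 2 * ‖u - xs‖^2 ≤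
      (1:ℝ)/2 * ‖u - (xs - τ • gradient f xs)‖^2 + τ * lam * (norm0 u : ℝ) := by
    intro u
    rw [half_norm_sub_sub_smul_sq xs (gradient f xs) u τ]
    have h : 0 ≤ ⟪gradient f xs, u - xs⟫ + L / 2 * ‖u - xs‖ ^ 2
        + lam * (norm0 u : ℝ) - lam * (norm0 xs : ℝ) := by
      linarith [hsmooth xs u, hmin u]
    linarith [mul_nonneg hτ0.le h]
  have hmem : xs ∈ proxL0 (τ * lam) (xs - τ • gradient f xs) := fun u =>
    (le_add_of_nonneg_right (by positivity)).trans (hgrowth u)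
  refine ⟨Set.Subset.antisymm (fun w hw => ?_) (Set.singleton_subset_iff.2 hmem), hmem⟩
  have h : (1 - τ * L) / 2 * ‖w - xs‖^2 ≤ 0 := by linarith [hgrowth w, hw xs]
  have hsq : ‖w - xs‖^2 ≤ 0 := nonpos_of_mul_nonpos_right h (by positivity)
  have hnorm : ‖w - xs‖ = 0 := pow_eq_zero_iff two_ne_zero |>.1 (le_antisymm hsq (sq_nonneg _))
  exact sub_eq_zero.1 (norm_eq_zero.1 hnorm)
end

section
/- Let f: ℝⁿ → ℝ be continuously differentiable and convex, let λ > 0, and let x* be a τ-stationary point of min_{x∈ℝⁿ} f(x) + λ‖x‖₀ for some τ > 0. Set ε* = min{ min_{i: x*_i ≠ 0} |x*_i|, √(τλ/(2n)) } if x* ≠ 0 and ε* = √(τλ/(2n)) if x* = 0. Then for every x ∈ ℝⁿ with ‖x − x*‖ < ε*, one has f(x) + λ‖x‖₀ ≥ f(x*) + λ‖x*‖₀; in particular x* is a local minimizer of f + λ‖·‖₀. -/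
open scoped RealInnerProductSpace

theorem ConvexOn.add_inner_gradient_le {E : Type*} [NormedAddCommGroup E] [InnerProductSpace ℝ E]
    [CompleteSpace E] {f : E → ℝ} {x : E} (hconv : ConvexOn ℝ Set.univ f)
    (hf : DifferentiableAt ℝ f x) (y : E) :
    f x + ⟪gradient f x, y - x⟫ ≤ f y := by
  have hline : ConvexOn ℝ Set.univ (f ∘ AffineMap.lineMap (k := ℝ) x y) := by
    simpa using hconv.comp_affineMap (AffineMap.lineMap (k := ℝ) x y)
  have hderiv : HasDerivAt (f ∘ AffineMap.lineMap (k := ℝ) x y) (fderiv ℝ f x (y - x)) 0 := by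
    refine HasFDerivAt.comp_hasDerivAt 0 ?_ AffineMap.hasDerivAt_lineMap
    simpa using hf.hasFDerivAt
  have h := hline.le_slope_of_hasDerivAt (Set.mem_univ 0) (Set.mem_univ 1) one_pos hderiv
  simp only [slope_def_field, Function.comp_apply, AffineMap.lineMap_apply_one,
    AffineMap.lineMap_apply_zero, sub_zero, div_one] at h
  rw [inner_gradient_left]
  linarith

theorem norm0_add_single_le {n : ℕ} (x : EuclideanSpace ℝ (Fin n)) (i : Fin n) (t : ℝ) :
    norm0 (x + EuclideanSpace.single i t) ≤ norm0 x + if x i = 0 then 1 else 0 := by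
  have hsub : (Finset.univ.filter fun j => (x + EuclideanSpace.single i t) j ≠ 0) ⊆
      insert i (Finset.univ.filter fun j => x j ≠ 0) := by
    intro j hj
    by_cases hji : j = i
    · simp [hji]
    · simpa [hji] using hj
  refine (Finset.card_le_card hsub).trans ?_
  split_ifs with hi
  · exact Finset.card_insert_le _ _
  · rw [Finset.insert_eq_of_mem (by simpa using hi)]
    rfl

theorem norm_add_single_neg_sq {n : ℕ} (v : EuclideanSpace ℝ (Fin n)) (i : Fin n) :
    ‖v + EuclideanSpace.single i (-(v i))‖ ^ 2 = ‖v‖ ^ 2 - v i ^ 2 := by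
  rw [norm_add_sq_real, EuclideanSpace.inner_single_right, PiLp.norm_single]
  simp
  ring

theorem sq_apply_le_of_mem_proxL0 {n : ℕ} {c : ℝ} (hc : 0 ≤ c)
    {x v : EuclideanSpace ℝ (Fin n)} (hx : x ∈ proxL0 c (x - v)) (i : Fin n) :
    v i ^ 2 ≤ if x i = 0 then 2 * c else 0 := by
  have h := hx (x + EuclideanSpace.single i (-(v i)))
  have hsub : x + EuclideanSpace.single i (-(v i)) - (x - v) =
      v + EuclideanSpace.single i (-(v i)) := by abel
  rw [hsub, norm_add_single_neg_sq, sub_sub_cancel] at h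
  have hcard : (norm0 (x + EuclideanSpace.single i (-(v i))) : ℝ) ≤
      norm0 x + if x i = 0 then 1 else 0 := by
    exact_mod_cast norm0_add_single_le x i (-(v i))
  have hmul := mul_le_mul_of_nonneg_left hcard hc
  split_ifs at hmul ⊢ <;> linarith

theorem norm_sq_le_of_mem_proxL0 {n : ℕ} {c : ℝ} (hc : 0 ≤ c)
    {x v : EuclideanSpace ℝ (Fin n)} (hx : x ∈ proxL0 c (x - v)) :
    ‖v‖ ^ 2 ≤ n * (2 * c) := by
  rw [EuclideanSpace.real_norm_sq_eq]
  refine (Finset.sum_le_card_nsmul _ _ (2 * c) fun i _ => ?_).trans (by simp)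
  refine (sq_apply_le_of_mem_proxL0 hc hx i).trans ?_
  split_ifs <;> linarith

theorem apply_eq_zero_of_mem_proxL0 {n : ℕ} {c : ℝ} (hc : 0 ≤ c)
    {x v : EuclideanSpace ℝ (Fin n)} (hx : x ∈ proxL0 c (x - v)) {i : Fin n} (hi : x i ≠ 0) :
    v i = 0 := by
  have h := sq_apply_le_of_mem_proxL0 hc hx i
  rw [if_neg hi] at h
  exact pow_eq_zero_iff two_ne_zero |>.mp (le_antisymm h (sq_nonneg _))

theorem apply_ne_zero_of_norm_sub_lt {n : ℕ} {x y : EuclideanSpace ℝ (Fin n)} {i : Fin n}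
    (h : ‖y - x‖ < |x i|) : y i ≠ 0 := by
  intro hy
  have hle := PiLp.norm_apply_le (y - x) i
  simp only [PiLp.sub_apply, hy, zero_sub, norm_neg, Real.norm_eq_abs] at hle
  linarith

/-- A proximal point `x` of `x - v` is a local minimizer of the linear model
`y ↦ ⟪v, y - x⟫ + c ‖y‖₀`. -/
theorem mul_norm0_le_inner_add_of_mem_proxL0 {n : ℕ} {c : ℝ} (hc : 0 ≤ c)
    {x v y : EuclideanSpace ℝ (Fin n)} (hx : x ∈ proxL0 c (x - v))
    (hsupp : ∀ i, x i ≠ 0 → y i ≠ 0) (hy : ‖y - x‖ ≤ √(c / (2 * n))) :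
    c * norm0 x ≤ ⟪v, y - x⟫ + c * norm0 y := by
  have hsub : (Finset.univ.filter fun i => x i ≠ 0) ⊆ Finset.univ.filter fun i => y i ≠ 0 := by
    intro i
    simpa using hsupp i
  rcases (Finset.card_le_card hsub).eq_or_lt with hcard | hcard
  · have hfilter := Finset.eq_of_subset_of_card_le hsub hcard.ge
    have hinner : ⟪v, y - x⟫ = 0 := by
      rw [PiLp.inner_apply]
      refine Finset.sum_eq_zero fun i _ => ?_
      by_cases hi : x i = 0
      · have hyi : y i = 0 := by
          have := Finset.ext_iff.mp hfilter i
          simpa [hi] using this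
        simp [hi, hyi]
      · simp [apply_eq_zero_of_mem_proxL0 hc hx hi]
    have hnorm0 : norm0 x = norm0 y := hcard
    rw [hinner, hnorm0, zero_add]
  · have hnorm0 : (norm0 x : ℝ) + 1 ≤ norm0 y := by
      exact_mod_cast (show norm0 x + 1 ≤ norm0 y from hcard)
    have hprod : ‖v‖ * ‖y - x‖ ≤ c := by
      refine abs_le_of_sq_le_sq' ?_ hc |>.2
      have hy2 : ‖y - x‖ ^ 2 ≤ c / (2 * n) :=
        (Real.le_sqrt (norm_nonneg _) (by positivity)).mp hy
      calc (‖v‖ * ‖y - x‖) ^ 2 = ‖v‖ ^ 2 * ‖y - x‖ ^ 2 := mul_pow _ _ _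
        _ ≤ (n * (2 * c)) * (c / (2 * n)) :=
          mul_le_mul (norm_sq_le_of_mem_proxL0 hc hx) hy2 (sq_nonneg _) (by positivity)
        _ ≤ c ^ 2 := by
          rcases eq_or_ne (n : ℝ) 0 with hn | hn
          · simp [hn, sq_nonneg]
          · exact le_of_eq (by field_simp)
    have hinner := neg_le_of_abs_le (abs_real_inner_le_norm v (y - x))
    nlinarith [mul_le_mul_of_nonneg_left hnorm0 hc]

/-- if `f` is convex, a τ-stationary point is a local minimizer of
`f + λ‖·‖₀` on the ball of radius `ε*` (Theorem 2.1, part 2, first claim). -/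
theorem tau_stationary_local_minimizer {n : ℕ}
    (f : EuclideanSpace ℝ (Fin n) → ℝ) (hf : ContDiff ℝ 1 f)
    (hconv : ConvexOn ℝ Set.univ f)
    (lam τ : ℝ) (hlam : 0 < lam) (hτ : 0 < τ)
    (xs : EuclideanSpace ℝ (Fin n)) (hstat : IsTauStationary f lam τ xs)
    (ε : ℝ)
    (hε0 : xs = 0 → ε = Real.sqrt (τ * lam / (2 * n)))
    (hε1 : ∀ h : xs ≠ 0,
      ε = min
        (((Finset.univ.filter fun i => xs i ≠ 0).inf'
          (by
            rw [Finset.filter_nonempty_iff]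
            by_contra hc
            push_neg at hc
            exact h (by ext i; simpa using hc i (Finset.mem_univ i)))
          fun i => |xs i|))
        (Real.sqrt (τ * lam / (2 * n)))) :
    ∀ x : EuclideanSpace ℝ (Fin n), ‖x - xs‖ < ε →
      f xs + lam * (norm0 xs : ℝ) ≤ f x + lam * (norm0 x : ℝ) := by
  intro x hx
  have hc : 0 ≤ τ * lam := by positivity
  have hsupp : ∀ i, xs i ≠ 0 → x i ≠ 0 := by
    intro i hi
    have hne : xs ≠ 0 := fun h => hi (by simp [h])
    rw [hε1 hne] at hx
    exact apply_ne_zero_of_norm_sub_lt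
      (hx.trans_le ((min_le_left _ _).trans (Finset.inf'_le _ (by simpa using hi))))
  have hball : ‖x - xs‖ ≤ √(τ * lam / (2 * n)) := by
    by_cases h : xs = 0
    · exact hx.le.trans_eq (hε0 h)
    · exact hx.le.trans ((hε1 h).trans_le (min_le_right _ _))
  have hmodel := mul_norm0_le_inner_add_of_mem_proxL0 hc hstat hsupp hball
  rw [real_inner_smul_left, mul_assoc, mul_assoc, ← mul_add] at hmodel
  have hgrad := hconv.add_inner_gradient_le (hf.differentiable one_ne_zero xs) x
  linarith [le_of_mul_le_mul_left hmodel hτ]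
end

section
/- Let f: ℝⁿ → ℝ be continuously differentiable and strongly convex with constant ℓ > 0, and let λ > 0. If x* is a τ-stationary point of min_{x∈ℝⁿ} f(x) + λ‖x‖₀ with τ ≥ 1/ℓ, then x* is a global minimizer: f(x) + λ‖x‖₀ ≥ f(x*) + λ‖x*‖₀ for all x ∈ ℝⁿ. -/
open scoped RealInnerProductSpace

/-- if `f` is strongly convex with constant `ℓ` and `τ ≥ 1/ℓ`, then a
τ-stationary point is a global minimizer of `f + λ‖·‖₀` (Theorem 2.1, part 2). -/
theorem tau_stationary_global_minimizer {n : ℕ}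
    (f : EuclideanSpace ℝ (Fin n) → ℝ) (hf : ContDiff ℝ 1 f)
    (ℓ : ℝ) (hℓ : 0 < ℓ)
    (hsconv : ∀ x z : EuclideanSpace ℝ (Fin n),
      f x + ⟪gradient f x, z - x⟫ + ℓ / 2 * ‖z - x‖ ^ 2 ≤ f z)
    (lam τ : ℝ) (hlam : 0 < lam) (hτ : 1 / ℓ ≤ τ)
    (xs : EuclideanSpace ℝ (Fin n)) (hstat : IsTauStationary f lam τ xs) :
    ∀ x : EuclideanSpace ℝ (Fin n),
      f xs + lam * (norm0 xs : ℝ) ≤ f x + lam * (norm0 x : ℝ) := by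
  intro x
  have hτpos : 0 < τ := (one_div_pos.mpr hℓ).trans_le hτ
  have hprox := hstat x
  rw [show xs - (xs - τ • gradient f xs) = τ • gradient f xs by abel,
    show x - (xs - τ • gradient f xs) = (x - xs) + τ • gradient f xs by abel,
    norm_add_sq_real, real_inner_smul_right, real_inner_comm] at hprox
  have hτℓ : 1 ≤ τ * ℓ := (div_le_iff₀ hℓ).mp hτ
  have hquad : ‖x - xs‖ ^ 2 ≤ τ * ℓ * ‖x - xs‖ ^ 2 :=
    le_mul_of_one_le_left (sq_nonneg _) hτℓ
  have hconv := mul_le_mul_of_nonneg_left (hsconv xs x) hτpos.le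
  refine le_of_mul_le_mul_left ?_ hτpos
  linarith
end

section
/- Let f: ℝⁿ → ℝ be continuously differentiable and strongly convex with constant ℓ > 0, and let λ > 0. If x* is a τ-stationary point of min_{x∈ℝⁿ} f(x) + λ‖x‖₀ with τ > 1/ℓ, then x* is the unique global minimizer: f(x) + λ‖x‖₀ > f(x*) + λ‖x*‖₀ for all x ∈ ℝⁿ with x ≠ x*. -/
open scoped RealInnerProductSpace

/-- if `f` is strongly convex with constant `ℓ` and `τ > 1/ℓ`, then a
τ-stationary point is the unique global minimizer of `f + λ‖·‖₀`. -/
theorem tau_stationary_unique_global_minimizer {n : ℕ}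
    (f : EuclideanSpace ℝ (Fin n) → ℝ) (hf : ContDiff ℝ 1 f)
    (ℓ : ℝ) (hℓ : 0 < ℓ)
    (hsconv : ∀ x z : EuclideanSpace ℝ (Fin n),
      f x + ⟪gradient f x, z - x⟫ + ℓ / 2 * ‖z - x‖ ^ 2 ≤ f z)
    (lam τ : ℝ) (hlam : 0 < lam) (hτ : 1 / ℓ < τ)
    (xs : EuclideanSpace ℝ (Fin n)) (hstat : IsTauStationary f lam τ xs) :
    ∀ x : EuclideanSpace ℝ (Fin n), x ≠ xs →
      f xs + lam * (norm0 xs : ℝ) < f x + lam * (norm0 x : ℝ) := by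
  intro x hx
  have hτ0 : 0 < τ := (one_div_pos.mpr hℓ).trans hτ
  have hτℓ : 1 < τ * ℓ := (div_lt_iff₀ hℓ).mp hτ
  have hd : 0 < ‖x - xs‖ ^ 2 := pow_pos (norm_pos_iff.mpr (sub_ne_zero.mpr hx)) 2
  have hprox := hstat x
  have hxs : xs - (xs - τ • gradient f xs) = τ • gradient f xs := by abel
  have hxd : x - (xs - τ • gradient f xs) = (x - xs) + τ • gradient f xs := by abel
  rw [hxs, hxd, norm_add_sq_real, real_inner_smul_right, real_inner_comm] at hprox
  have hconv := mul_le_mul_of_nonneg_left (hsconv xs x) hτ0.le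
  have hgap := mul_lt_mul_of_pos_right hτℓ hd
  refine lt_of_mul_lt_mul_left ?_ hτ0.le
  linarith
end

section
/- Let f: ℝⁿ → ℝ be continuously differentiable, λ > 0, τ > 0, and let x* be a τ-stationary point of min_{x∈ℝⁿ} f(x) + λ‖x‖₀. Then for every x ∈ ℝⁿ: ⟨∇f(x*), x − x*⟩ + λ‖x‖₀ ≥ −(1/(2τ))‖x − x*‖² + λ‖x*‖₀. -/
open scoped RealInnerProductSpace

/-- the variational inequality (2.12) satisfied by any τ-stationary
point of `f + λ‖·‖₀`. -/
theorem tau_stationary_variational_inequality {n : ℕ}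
    (f : EuclideanSpace ℝ (Fin n) → ℝ) (hf : ContDiff ℝ 1 f)
    (lam τ : ℝ) (hlam : 0 < lam) (hτ : 0 < τ)
    (xs : EuclideanSpace ℝ (Fin n)) (hstat : IsTauStationary f lam τ xs) :
    ∀ x : EuclideanSpace ℝ (Fin n),
      -(1 / (2 * τ)) * ‖x - xs‖ ^ 2 + lam * (norm0 xs : ℝ) ≤
        ⟪gradient f xs, x - xs⟫ + lam * (norm0 x : ℝ) := by
  intro x
  have h := hstat x
  have hx : x - (xs - τ • gradient f xs) = (x - xs) + τ • gradient f xs := by abel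
  rw [sub_sub_cancel, hx, norm_add_sq_real, real_inner_smul_right, real_inner_comm] at h
  have key : 0 ≤ τ⁻¹ * ((1:ℝ) / 2 * ‖x - xs‖ ^ 2 + τ * ⟪gradient f xs, x - xs⟫
      + τ * lam * (norm0 x : ℝ) - τ * lam * (norm0 xs : ℝ)) :=
    mul_nonneg (inv_nonneg.2 hτ.le) (by linarith)
  field_simp at key ⊢
  linarith
end

section
/- Let f: ℝⁿ → ℝ be continuously differentiable, λ > 0, τ > 0, and x ∈ ℝⁿ. Define T = { i : |x_i − τ∇_i f(x)| ≥ √(2τλ) }. If the set Prox_{τλ‖·‖₀}(x − τ∇f(x)) is the singleton {x}, then ∇_i f(x) = 0 for all i ∈ T and x_i = 0 for all i ∉ T. -/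
open scoped RealInnerProductSpace

theorem l0_objective_eq_sum {n : ℕ} (c : ℝ) (w z : EuclideanSpace ℝ (Fin n)) :
    (1:ℝ)/2 * ‖w - z‖^2 + c * (norm0 w : ℝ) =
      ∑ j, ((1:ℝ)/2 * (w j - z j)^2 + c * (if w j ≠ 0 then 1 else 0)) := by
  rw [Finset.sum_add_distrib, ← Finset.mul_sum, ← Finset.mul_sum, EuclideanSpace.real_norm_sq_eq,
    Finset.sum_boole]
  simp [norm0]

theorem l0_objective_update {n : ℕ} (c : ℝ) (w z : EuclideanSpace ℝ (Fin n)) (i : Fin n) (t : ℝ) :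
    ((1:ℝ)/2 * ‖WithLp.toLp 2 (Function.update w i t) - z‖^2 +
        c * (norm0 (WithLp.toLp 2 (Function.update w i t)) : ℝ)) -
      ((1:ℝ)/2 * ‖w - z‖^2 + c * (norm0 w : ℝ)) =
    ((1:ℝ)/2 * (t - z i)^2 + c * (if t ≠ 0 then 1 else 0)) -
      ((1:ℝ)/2 * (w i - z i)^2 + c * (if w i ≠ 0 then 1 else 0)) := by
  rw [l0_objective_eq_sum, l0_objective_eq_sum, ← Finset.sum_sub_distrib, Finset.sum_eq_single i]
  · simp
  · intro j _ hj
    simp [Function.update_of_ne hj]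
  · simp

/-- A unique minimizer is a strict minimizer in each coordinate. -/
theorem coord_lt_of_proxL0_eq_singleton {n : ℕ} {c : ℝ} {x z : EuclideanSpace ℝ (Fin n)}
    (h : proxL0 c z = {x}) (i : Fin n) {t : ℝ} (ht : t ≠ x i) :
    (1:ℝ)/2 * (x i - z i)^2 + c * (if x i ≠ 0 then 1 else 0) <
      (1:ℝ)/2 * (t - z i)^2 + c * (if t ≠ 0 then 1 else 0) := by
  have hx : x ∈ proxL0 c z := h ▸ Set.mem_singleton x
  have hupd := l0_objective_update c x z i t
  by_contra! hle
  have hmem : WithLp.toLp 2 (Function.update x i t) ∈ proxL0 c z := fun u => by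
    linarith [hx u]
  rw [h, Set.mem_singleton_iff] at hmem
  apply ht
  simpa using congrArg (fun v : EuclideanSpace ℝ (Fin n) => v i) hmem

/-- if `Prox_{τλ‖·‖₀}(x − τ∇f(x)) = {x}`, then the stationary
equation `F_τ(x;T) = 0` holds (first implication of Theorem 2.2). -/
theorem prox_singleton_implies_stationary_equation {n : ℕ}
    (f : EuclideanSpace ℝ (Fin n) → ℝ) (hf : ContDiff ℝ 1 f)
    (lam τ : ℝ) (hlam : 0 < lam) (hτ : 0 < τ)
    (x : EuclideanSpace ℝ (Fin n))
    (hsingle : proxL0 (τ * lam) (x - τ • gradient f x) = {x}) :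
    ∀ i : Fin n,
      (Real.sqrt (2 * τ * lam) ≤ |x i - τ * gradient f x i| → gradient f x i = 0) ∧
      (|x i - τ * gradient f x i| < Real.sqrt (2 * τ * lam) → x i = 0) := by
  intro i
  have hc : 0 < τ * lam := mul_pos hτ hlam
  have hlt := fun t => coord_lt_of_proxL0_eq_singleton (t := t) hsingle i
  have hz : (x - τ • gradient f x) i = x i - τ * gradient f x i := by simp
  rw [hz] at hlt
  generalize hzi : x i - τ * gradient f x i = z at hlt ⊢
  refine ⟨fun h => ?_, fun h => ?_⟩
  · suffices hxz : z = x i by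
      have : τ * gradient f x i = 0 := by linarith
      exact (mul_eq_zero.mp this).resolve_left hτ.ne'
    by_contra hne
    have hsq : 2 * τ * lam ≤ z ^ 2 := by
      simpa using (Real.sqrt_le_left (abs_nonneg z)).mp h
    have hlt := hlt z hne
    split_ifs at hlt with h₁ h₂ h₂
    all_goals simp_all
    all_goals nlinarith [sq_nonneg (x i - z)]
  · by_contra hne
    have hsq : z ^ 2 < 2 * τ * lam := by
      simpa using (Real.lt_sqrt (abs_nonneg z)).mp h
    have hlt := hlt 0 (Ne.symm hne)
    rw [if_pos hne, if_neg (by simp)] at hlt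
    nlinarith [sq_nonneg (x i - z)]
end

section
/- Let f: ℝⁿ → ℝ be continuously differentiable with ∇f(0) ≠ 0, let τ > 0, and define λ̲ = min{ (τ/2)|∇_i f(0)|² : ∇_i f(0) ≠ 0 }. If 0 < λ < λ̲, then the zero vector is not a τ-stationary point of min_{x∈ℝⁿ} f(x) + λ‖x‖₀. -/
open scoped RealInnerProductSpace

theorem norm0_single_le_one {n : ℕ} (i : Fin n) (a : ℝ) :
    norm0 (EuclideanSpace.single i a) ≤ 1 := by
  calc norm0 (EuclideanSpace.single i a)
      ≤ ({i} : Finset (Fin n)).card := Finset.card_le_card fun j hj => by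
        by_contra hji
        simp_all
    _ = 1 := Finset.card_singleton i

theorem half_sq_le_of_zero_mem_proxL0 {n : ℕ} {c : ℝ} (hc : 0 ≤ c)
    {z : EuclideanSpace ℝ (Fin n)} (h : 0 ∈ proxL0 c z) (i : Fin n) :
    1 / 2 * z i ^ 2 ≤ c := by
  have hmin := h (EuclideanSpace.single i (z i))
  have hzero : norm0 (0 : EuclideanSpace ℝ (Fin n)) = 0 := by simp [norm0]
  have hone : (norm0 (EuclideanSpace.single i (z i)) : ℝ) ≤ 1 := by
    exact_mod_cast norm0_single_le_one i (z i)
  have hcard := mul_le_mul_of_nonneg_left hone hc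
  have hdist : ‖EuclideanSpace.single i (z i) - z‖ ^ 2 = ‖z‖ ^ 2 - z i ^ 2 := by
    rw [norm_sub_sq_real, EuclideanSpace.inner_single_left, PiLp.norm_single,
      Real.norm_eq_abs, sq_abs, conj_trivial]
    ring
  rw [hdist, hzero, zero_sub, norm_neg] at hmin
  push_cast at hmin
  linarith

/-- if `∇f(0) ≠ 0` and `0 < λ < λ̲`, then `0` is not a
τ-stationary point of `f + λ‖·‖₀` (Remark 2.1). -/
theorem zero_not_tau_stationary {n : ℕ}
    (f : EuclideanSpace ℝ (Fin n) → ℝ) (hf : ContDiff ℝ 1 f)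
    (τ : ℝ) (hτ : 0 < τ) (hg : gradient f 0 ≠ 0)
    (lamLower : ℝ)
    (hlamLower : lamLower =
      (Finset.univ.filter fun i => gradient f 0 i ≠ 0).inf'
        (by
          rw [Finset.filter_nonempty_iff]
          by_contra hc
          push_neg at hc
          exact hg (by ext i; simpa using hc i (Finset.mem_univ i)))
        (fun i => τ / 2 * |gradient f 0 i| ^ 2))
    (lam : ℝ) (hlam0 : 0 < lam) (hlam : lam < lamLower) :
    ¬ IsTauStationary f lam τ 0 := by
  intro h
  obtain ⟨i, hi⟩ : ∃ i, gradient f 0 i ≠ 0 := by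
    by_contra! hc
    exact hg (by ext i; simpa using hc i)
  have hlt : lam < τ / 2 * |gradient f 0 i| ^ 2 :=
    hlam.trans_le (hlamLower ▸ Finset.inf'_le _ (by simpa using hi))
  rw [sq_abs] at hlt
  have hle := half_sq_le_of_zero_mem_proxL0 (mul_pos hτ hlam0).le h i
  simp only [zero_sub, PiLp.neg_apply, PiLp.smul_apply, smul_eq_mul] at hle
  nlinarith [mul_lt_mul_of_pos_left hlt hτ]
end

section
/- Let f: ℝⁿ → ℝ be continuously differentiable, let τ > 0, and define λ̄ = max_i (τ/2)|∇_i f(0)|². If λ > λ̄, then the zero vector is a τ-stationary point of min_{x∈ℝⁿ} f(x) + λ‖x‖₀. -/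
open scoped RealInnerProductSpace

/-- Zero is a hard-thresholding output of `z` as soon as no entry of `z` exceeds the threshold. -/
theorem zero_mem_proxL0 {n : ℕ} {c : ℝ} {z : EuclideanSpace ℝ (Fin n)}
    (h : ∀ i, (1:ℝ)/2 * z i ^ 2 ≤ c) : 0 ∈ proxL0 c z := by
  intro u
  have key : ∑ i, (1:ℝ)/2 * z i ^ 2 ≤
      ∑ i, ((1:ℝ)/2 * (u i - z i) ^ 2 + c * if u i ≠ 0 then 1 else 0) := by
    refine Finset.sum_le_sum fun i _ => ?_
    by_cases hu : u i = 0
    · simp [hu]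
    · simpa [hu] using (h i).trans (le_add_of_nonneg_left (by positivity))
  rw [Finset.sum_add_distrib, ← Finset.mul_sum, ← Finset.mul_sum, ← Finset.mul_sum,
    Finset.sum_boole] at key
  simpa [norm0, EuclideanSpace.real_norm_sq_eq] using key

/-- if `λ > λ̄ = max_i (τ/2)|∇_i f(0)|²`, then `0` is a
τ-stationary point of `f + λ‖·‖₀` (Remark 2.1). -/
theorem zero_is_tau_stationary {n : ℕ} (hn : 0 < n)
    (f : EuclideanSpace ℝ (Fin n) → ℝ) (hf : ContDiff ℝ 1 f)
    (τ : ℝ) (hτ : 0 < τ)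
    (lamUpper : ℝ)
    (hlamUpper : lamUpper =
      Finset.univ.sup' (Finset.univ_nonempty_iff.mpr ⟨⟨0, hn⟩⟩)
        (fun i : Fin n => τ / 2 * |gradient f 0 i| ^ 2))
    (lam : ℝ) (hlam : lamUpper < lam) :
    IsTauStationary f lam τ 0 := by
  refine zero_mem_proxL0 fun i => ?_
  have hi : τ / 2 * |gradient f 0 i| ^ 2 ≤ lam := by
    refine le_trans ?_ hlam.le
    rw [hlamUpper]
    exact Finset.le_sup' (fun i : Fin n => τ / 2 * |gradient f 0 i| ^ 2) (Finset.mem_univ i)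
  rw [sq_abs] at hi
  calc (1:ℝ)/2 * (0 - τ • gradient f 0) i ^ 2
      = τ * (τ / 2 * gradient f 0 i ^ 2) := by
        simp only [zero_sub, PiLp.neg_apply, PiLp.smul_apply, smul_eq_mul]
        ring
    _ ≤ τ * lam := by gcongr
end

section
/- Let f: ℝⁿ → ℝ be twice continuously differentiable, x, d ∈ ℝⁿ, L > 0, and let T, J ⊆ {1,…,n} be disjoint index sets with d_i = −x_i for all i ∉ T and x_i = 0 for all i ∉ T ∪ J. Suppose the spectral norm of the submatrix ∇²_{T∪J, T∪J} f(x) is at most L, and d_T satisfies the Newton equation ∇²_{T,T} f(x) d_T = ∇²_{T,J} f(x) x_J − ∇_T f(x). Then ‖∇_T f(x)‖ ≤ L ‖d‖. -/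
open scoped RealInnerProductSpace

/-- The Hessian matrix of `f` at `x`: `hess f x i j = ∂²f/∂xᵢ∂xⱼ (x)`. -/
noncomputable def hess {n : ℕ} (f : EuclideanSpace ℝ (Fin n) → ℝ)
    (x : EuclideanSpace ℝ (Fin n)) : Matrix (Fin n) (Fin n) ℝ :=
  fun i j =>
    iteratedFDeriv ℝ 2 f x ![EuclideanSpace.single i 1, EuclideanSpace.single j 1]

/-- the gradient bound `‖∇_T f(x)‖ ≤ L‖d‖` (inequality (3.24)),
where the spectral norm hypothesis on `∇²_{T∪J,T∪J} f(x)` is expressed by the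
equivalent operator inequality. -/
theorem gradient_subvector_bound {n : ℕ}
    (f : EuclideanSpace ℝ (Fin n) → ℝ) (hf : ContDiff ℝ 2 f)
    (x d : EuclideanSpace ℝ (Fin n)) (L : ℝ) (hL : 0 < L)
    (T J : Finset (Fin n)) (hTJ : Disjoint T J)
    (hd : ∀ i ∉ T, d i = -x i)
    (hx : ∀ i ∉ T ∪ J, x i = 0)
    (hspec : ∀ v : Fin n → ℝ,
      Real.sqrt (∑ i ∈ T ∪ J, (∑ j ∈ T ∪ J, hess f x i j * v j) ^ 2) ≤
        L * Real.sqrt (∑ i ∈ T ∪ J, v i ^ 2))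
    (hnewton : ∀ i ∈ T, ∑ j ∈ T, hess f x i j * d j =
        ∑ j ∈ J, hess f x i j * x j - gradient f x i) :
    Real.sqrt (∑ i ∈ T, gradient f x i ^ 2) ≤ L * ‖d‖ := by
  have hgrad : ∀ i ∈ T, ∑ j ∈ T ∪ J, hess f x i j * d j = -gradient f x i := by
    intro i hi
    have hJ : ∑ j ∈ J, hess f x i j * d j = -∑ j ∈ J, hess f x i j * x j := by
      rw [← Finset.sum_neg_distrib]
      refine Finset.sum_congr rfl fun j hj => ?_
      rw [hd j (Finset.disjoint_right.mp hTJ hj), mul_neg]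
    rw [Finset.sum_union hTJ, hnewton i hi, hJ]
    ring
  calc Real.sqrt (∑ i ∈ T, gradient f x i ^ 2)
      = Real.sqrt (∑ i ∈ T, (∑ j ∈ T ∪ J, hess f x i j * d j) ^ 2) := by
        congr 1
        refine Finset.sum_congr rfl fun i hi => ?_
        rw [hgrad i hi, neg_sq]
    _ ≤ Real.sqrt (∑ i ∈ T ∪ J, (∑ j ∈ T ∪ J, hess f x i j * d j) ^ 2) :=
        Real.sqrt_le_sqrt <| Finset.sum_le_sum_of_subset_of_nonneg
          Finset.subset_union_left fun _ _ _ => sq_nonneg _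
    _ ≤ L * Real.sqrt (∑ i ∈ T ∪ J, d i ^ 2) := hspec d
    _ ≤ L * ‖d‖ := by
        rw [EuclideanSpace.norm_eq]
        simp only [Real.norm_eq_abs, sq_abs]
        exact mul_le_mul_of_nonneg_left (Real.sqrt_le_sqrt <|
          Finset.sum_le_sum_of_subset_of_nonneg (Finset.subset_univ _)
            fun _ _ _ => sq_nonneg _) hL.le
end

section
/- Let x, g ∈ ℝⁿ, τ > 0, λ > 0, and let T' ⊆ {1,…,n} satisfy supp(x) ⊆ T'. Define T = { i : |x_i − τ g_i| ≥ √(2τλ) }, S = T \ T', and J = T' \ T, and suppose S ≠ ∅. Then −2⟨x_J, g_J⟩ ≤ nτ‖g_T‖² − τ‖g_{T'}‖² − (1/τ)‖x_{T̄}‖², where T̄ is the complement of T, v_I denotes the sub-vector of v on the index set I, and ⟨·,·⟩ and ‖·‖ are the Euclidean inner product and norm. -/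
/-- the key estimate (3.28) in the descent-property analysis of
the NL0R algorithm. -/
theorem descent_key_estimate {n : ℕ} (x g : Fin n → ℝ)
    (τ lam : ℝ) (hτ : 0 < τ) (hlam : 0 < lam)
    (T' : Finset (Fin n)) (hsupp : ∀ i, x i ≠ 0 → i ∈ T')
    (T : Finset (Fin n))
    (hT : T = Finset.univ.filter fun i => Real.sqrt (2 * τ * lam) ≤ |x i - τ * g i|)
    (hS : (T \ T').Nonempty) :
    -2 * ∑ i ∈ T' \ T, x i * g i ≤
      n * τ * ∑ i ∈ T, g i ^ 2 - τ * ∑ i ∈ T', g i ^ 2 -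
        (1 / τ) * ∑ i ∈ Tᶜ, x i ^ 2 := by
  obtain ⟨s, hs⟩ := hS
  obtain ⟨hsT, hsT'⟩ := Finset.mem_sdiff.mp hs
  have hxs : x s = 0 := by
    by_contra h
    exact hsT' (hsupp s h)
  have hs_ge : Real.sqrt (2 * τ * lam) ≤ |τ * g s| := by
    have h := hsT
    rw [hT, Finset.mem_filter] at h
    simpa [hxs] using h.2
  have hpoint : ∀ i ∈ T' \ T,
      -2 * (x i * g i) ≤ τ * g s ^ 2 - τ * g i ^ 2 - (1 / τ) * x i ^ 2 := by
    intro i hi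
    have hiT := (Finset.mem_sdiff.mp hi).2
    rw [hT, Finset.mem_filter] at hiT
    have hlt : |x i - τ * g i| < Real.sqrt (2 * τ * lam) := by
      by_contra h
      exact hiT ⟨Finset.mem_univ i, not_lt.mp h⟩
    have hsq := sq_le_sq.mpr (hlt.le.trans hs_ge)
    have hdiff : τ * g s ^ 2 - τ * g i ^ 2 - (1 / τ) * x i ^ 2 - -2 * (x i * g i) =
        ((τ * g s) ^ 2 - (x i - τ * g i) ^ 2) / τ := by
      field_simp
      ring
    have hnonneg := div_nonneg (sub_nonneg.mpr hsq) hτ.le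
    linarith
  have hsum := Finset.sum_le_sum hpoint
  simp only [Finset.sum_sub_distrib, ← Finset.mul_sum, Finset.sum_const, nsmul_eq_mul] at hsum
  have hx_compl : ∑ i ∈ T' \ T, x i ^ 2 = ∑ i ∈ Tᶜ, x i ^ 2 := by
    apply Finset.sum_subset
    · intro i hi
      exact Finset.mem_compl.mpr (Finset.mem_sdiff.mp hi).2
    · intro i hi hiJ
      have hxi : x i = 0 := by
        by_contra h
        exact hiJ (Finset.mem_sdiff.mpr ⟨hsupp i h, Finset.mem_compl.mp hi⟩)
      simp [hxi]
  have hT'_split := Finset.sum_inter_add_sum_sdiff T' T fun i => g i ^ 2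
  have hT_split := Finset.sum_inter_add_sum_sdiff T T' fun i => g i ^ 2
  rw [Finset.inter_comm] at hT_split
  have hgs : g s ^ 2 ≤ ∑ i ∈ T \ T', g i ^ 2 :=
    Finset.single_le_sum (f := fun i => g i ^ 2) (fun i _ => sq_nonneg (g i)) hs
  have hinter : 0 ≤ ∑ i ∈ T' ∩ T, g i ^ 2 := Finset.sum_nonneg fun i _ => sq_nonneg (g i)
  have hcard : ((T' \ T).card : ℝ) ≤ n := by
    exact_mod_cast card_finset_fin_le (T' \ T)
  have hn : (1 : ℝ) ≤ n := by
    exact_mod_cast s.pos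
  have hJ : ((T' \ T).card : ℝ) * g s ^ 2 ≤ n * ∑ i ∈ T \ T', g i ^ 2 :=
    mul_le_mul hcard hgs (sq_nonneg _) (Nat.cast_nonneg n)
  have hI := mul_le_mul_of_nonneg_right hn hinter
  have hmain : ((T' \ T).card : ℝ) * g s ^ 2 + ∑ i ∈ T' ∩ T, g i ^ 2 ≤
      n * ∑ i ∈ T, g i ^ 2 := by
    rw [← hT_split, mul_add]
    linarith
  have hscaled := mul_le_mul_of_nonneg_left hmain hτ.le
  rw [← hx_compl, ← hT'_split]
  linarith
end

section
/- Let f: ℝⁿ → ℝ be twice continuously differentiable, x ∈ ℝⁿ, g = ∇f(x), τ > 0, λ > 0, δ > 0, and L > 0. Let T' ⊆ {1,…,n} with supp(x) ⊆ T', define T = { i : |x_i − τ g_i| ≥ √(2τλ) }, and suppose T \ T' ≠ ∅. Let d ∈ ℝⁿ satisfy d_i = −x_i for i ∉ T, the Newton equation ∇²_{T,T} f(x) d_T = ∇²_{T, T̄} f(x) x_{T̄} − g_T, the condition ⟨g_T, d_T⟩ ≤ −δ‖d‖² + (1/(4τ))‖x_{T̄}‖², and the bound ‖g_T‖ ≤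 L‖d‖. If ρ := min{ (2δ − nτL²)/2, (2 − nτ)/2 } > 0, then ⟨g, d⟩ ≤ −ρ‖d‖² − (τ/2)‖g_{T'}‖². -/
open scoped RealInnerProductSpace

/-- the Newton-direction case of the descent property (Lemma 3.2):
the Newton search direction is a descent direction with declining rate `ρ`. -/
theorem newton_direction_descent {n : ℕ}
    (f : EuclideanSpace ℝ (Fin n) → ℝ) (hf : ContDiff ℝ 2 f)
    (x : EuclideanSpace ℝ (Fin n)) (τ lam δ L : ℝ)
    (hτ : 0 < τ) (hlam : 0 < lam) (hδ : 0 < δ) (hL : 0 < L)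
    (T' : Finset (Fin n)) (hsupp : ∀ i, x i ≠ 0 → i ∈ T')
    (T : Finset (Fin n))
    (hT : T = Finset.univ.filter fun i =>
      Real.sqrt (2 * τ * lam) ≤ |x i - τ * gradient f x i|)
    (hS : (T \ T').Nonempty)
    (d : EuclideanSpace ℝ (Fin n))
    (hd : ∀ i ∉ T, d i = -x i)
    (hnewton : ∀ i ∈ T, ∑ j ∈ T, hess f x i j * d j =
        ∑ j ∈ Tᶜ, hess f x i j * x j - gradient f x i)
    (hcond : ∑ i ∈ T, gradient f x i * d i ≤
        -δ * ∑ i, d i ^ 2 + 1 / (4 * τ) * ∑ i ∈ Tᶜ, x i ^ 2)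
    (hbound : Real.sqrt (∑ i ∈ T, gradient f x i ^ 2) ≤
        L * Real.sqrt (∑ i, d i ^ 2))
    (ρ : ℝ) (hρdef : ρ = min ((2 * δ - n * τ * L ^ 2) / 2) ((2 - n * τ) / 2))
    (hρ : 0 < ρ) :
    ∑ i, gradient f x i * d i ≤
      -ρ * ∑ i, d i ^ 2 - τ / 2 * ∑ i ∈ T', gradient f x i ^ 2 := by
  obtain ⟨g, hg⟩ : ∃ g : Fin n → ℝ, ∀ i, gradient f x i = g i := ⟨_, fun _ => rfl⟩
  simp only [hg] at hT hcond hbound ⊢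
  obtain ⟨j, hj⟩ := hS
  obtain ⟨hjT, hjT'⟩ := Finset.mem_sdiff.mp hj
  have hxj : x j = 0 := by
    by_contra h
    exact hjT' (hsupp j h)
  have hthreshold : 2 * τ * lam ≤ τ ^ 2 * g j ^ 2 := by
    have h : √(2 * τ * lam) ≤ |x j - τ * g j| := by simpa [hT] using hjT
    have h2 := (Real.sqrt_le_left (abs_nonneg _)).mp h
    rw [sq_abs, hxj] at h2
    linarith
  have hoff : ∀ i ∈ T' \ T,
      g i * d i + 1 / (4 * τ) * x i ^ 2 ≤ τ / 2 * (g j ^ 2 - g i ^ 2) := by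
    intro i hi
    have hiT := (Finset.mem_sdiff.mp hi).2
    have h : |x i - τ * g i| < √(2 * τ * lam) := by simpa [hT] using hiT
    have h2 := (Real.lt_sqrt (abs_nonneg _)).mp h
    rw [sq_abs] at h2
    rw [hd i hiT, ← sub_nonneg]
    have e : τ / 2 * (g j ^ 2 - g i ^ 2) - (g i * -x i + 1 / (4 * τ) * x i ^ 2) =
        (τ ^ 2 * g j ^ 2 - (x i - τ * g i) ^ 2 + x i ^ 2 / 2) / (2 * τ) := by
      field_simp
      ring
    rw [e]
    have := sq_nonneg (x i)
    apply div_nonneg <;> linarith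
  have hcompl : ∑ i ∈ Tᶜ, (g i * d i + 1 / (4 * τ) * x i ^ 2) =
      ∑ i ∈ T' \ T, (g i * d i + 1 / (4 * τ) * x i ^ 2) := by
    symm
    apply Finset.sum_subset
    · intro i hi
      exact Finset.mem_compl.mpr (Finset.mem_sdiff.mp hi).2
    · intro i hi hi'
      have hiT := Finset.mem_compl.mp hi
      have hxi : x i = 0 := by
        by_contra h
        exact hi' (Finset.mem_sdiff.mpr ⟨hsupp i h, hiT⟩)
      simp [hd i hiT, hxi]
  have hsum := Finset.sum_le_sum hoff
  rw [← hcompl, Finset.sum_add_distrib, ← Finset.mul_sum, ← Finset.mul_sum,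
    Finset.sum_sub_distrib, Finset.sum_const, nsmul_eq_mul] at hsum
  have hsplit := Finset.sum_inter_add_sum_sdiff T' T fun i => g i ^ 2
  have htotal := Finset.sum_add_sum_compl T fun i => g i * d i
  have hinter : g j ^ 2 + ∑ i ∈ T' ∩ T, g i ^ 2 ≤ ∑ i ∈ T, g i ^ 2 := by
    rw [← Finset.sum_insert (f := fun i => g i ^ 2) (by simp [hjT'])]
    apply Finset.sum_le_sum_of_subset_of_nonneg
    · exact Finset.insert_subset hjT Finset.inter_subset_right
    · intros
      positivity
  have hinter_nonneg : 0 ≤ ∑ i ∈ T' ∩ T, g i ^ 2 := Finset.sum_nonneg fun _ _ => sq_nonneg _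
  have hcard : ((T' \ T).card : ℝ) + 1 ≤ n := by
    have h : (T' \ T).card < Fintype.card (Fin n) :=
      Finset.card_lt_univ_of_notMem (x := j) (by simp [hjT])
    rw [Fintype.card_fin] at h
    exact_mod_cast h
  have hd_nonneg : 0 ≤ ∑ i, d i ^ 2 := Finset.sum_nonneg fun _ _ => sq_nonneg _
  have hT_nonneg : 0 ≤ ∑ i ∈ T, g i ^ 2 := Finset.sum_nonneg fun _ _ => sq_nonneg _
  have hgT : ∑ i ∈ T, g i ^ 2 ≤ L ^ 2 * ∑ i, d i ^ 2 := by
    have h := pow_le_pow_left₀ (Real.sqrt_nonneg _) hbound 2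
    rwa [mul_pow, Real.sq_sqrt hT_nonneg, Real.sq_sqrt hd_nonneg] at h
  have hcount : ((T' \ T).card : ℝ) * g j ^ 2 + ∑ i ∈ T' ∩ T, g i ^ 2 ≤
      n * (L ^ 2 * ∑ i, d i ^ 2) := by
    calc ((T' \ T).card : ℝ) * g j ^ 2 + ∑ i ∈ T' ∩ T, g i ^ 2
        ≤ (T' \ T).card * ∑ i ∈ T, g i ^ 2 + ∑ i ∈ T, g i ^ 2 := by
          refine add_le_add (mul_le_mul_of_nonneg_left ?_ (Nat.cast_nonneg _)) ?_
          · linarith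
          · linarith [sq_nonneg (g j)]
      _ = ((T' \ T).card + 1) * ∑ i ∈ T, g i ^ 2 := by ring
      _ ≤ n * (L ^ 2 * ∑ i, d i ^ 2) := by gcongr
  have hrate : ρ * ∑ i, d i ^ 2 ≤ (2 * δ - n * τ * L ^ 2) / 2 * ∑ i, d i ^ 2 := by
    gcongr
    exact hρdef ▸ min_le_left _ _
  have hscaled := mul_le_mul_of_nonneg_left hcount (half_pos hτ).le
  rw [← hsplit, ← htotal]
  linarith
end

section
/- Let f: ℝⁿ → ℝ be twice continuously differentiable and strongly smooth with constant L > 0, let σ ∈ (0, 1/2), δ ∈ (0, min{1, 2L}], τ > 0, λ > 0, and x ∈ ℝⁿ with g = ∇f(x). Let T' ⊆ {1,…,n} with supp(x) ⊆ T', define T = { i : |x_i − τ g_i| ≥ √(2τλ) }, and suppose T \ T' ≠ ∅. Let d ∈ ℝⁿ satisfy d_i = −x_i for i ∉ T, the condition ⟨g_T, d_T⟩ ≤ −δ‖d‖² + (1/(4τ))‖x_{T̄}‖², and the bound ‖g_T‖ ≤ L‖d‖. Define ᾱ = min{ (1−2σ)/(L/δ − σ), 2(1−σ)δ/L, 1 }.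 Then for every α with 0 < α ≤ ᾱ and every τ with 0 < τ ≤ min{ αδ/(nL²), α/n, 1/(4L) }, the point x(α) defined by x(α)_i = x_i + α d_i for i ∈ T and x(α)_i = 0 for i ∉ T satisfies f(x(α)) ≤ f(x) + σα⟨g, d⟩. -/
open scoped RealInnerProductSpace

/-- The scalar inequality behind the Armijo condition, where `D = ‖d‖²`, `DT = ‖d_T‖²`,
`B = ‖x_{Tᶜ}‖²`, `A = ⟪g_T, d_T⟫` and `G = ⟪g_{Tᶜ}, x_{Tᶜ}⟫`. -/
lemma armijo_scalar_inequality {L σ δ τ α A B G D DT : ℝ} (hσ0 : 0 < σ) (hσ1 : σ < 1 / 2)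
    (hτ : 0 < τ) (hα0 : 0 < α) (hα1 : α ≤ 1) (hB : 0 ≤ B) (hDT : 0 ≤ DT) (hD : D = DT + B)
    (hLτ : L * τ ≤ 1 / 4) (hαδ : α * (L - σ * δ) ≤ δ * (1 - 2 * σ))
    (hA : A ≤ -δ * D + 1 / (4 * τ) * B) (hG : -G ≤ α * δ / 2 * D - B / (2 * τ)) :
    α * A - G + L / 2 * (α ^ 2 * DT + B) ≤ σ * α * (A - G) := by
  have hσα : σ * α ≤ 1 / 2 := by nlinarith
  have hA' := mul_le_mul_of_nonneg_left hA (show 0 ≤ α * (1 - σ) by nlinarith)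
  have hG' := mul_le_mul_of_nonneg_left hG (show 0 ≤ 1 - σ * α by linarith)
  have hDcoeff : (α / 2) * (α * (L - σ * δ) - δ * (1 - 2 * σ)) * D ≤ 0 :=
    mul_nonpos_of_nonpos_of_nonneg
      (mul_nonpos_of_nonneg_of_nonpos (by positivity) (by linarith)) (by linarith)
  have hBcoeff : (α * (1 - σ) - 2 * (1 - σ * α) + 2 * (L * τ) * (1 - α ^ 2)) *
      (B / (4 * τ)) ≤ 0 := by
    refine mul_nonpos_of_nonpos_of_nonneg ?_ (by positivity)
    nlinarith [mul_le_mul_of_nonneg_right hLτ (show 0 ≤ 1 - α ^ 2 by nlinarith)]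
  have hsum : α * (1 - σ) * (-δ * D + 1 / (4 * τ) * B) +
      (1 - σ * α) * (α * δ / 2 * D - B / (2 * τ)) + L / 2 * (α ^ 2 * DT + B) =
      (α / 2) * (α * (L - σ * δ) - δ * (1 - 2 * σ)) * D +
      (α * (1 - σ) - 2 * (1 - σ * α) + 2 * (L * τ) * (1 - α ^ 2)) * (B / (4 * τ)) := by
    rw [hD]
    field_simp
    ring
  linarith

/-- If the entries of `x - τ g` off `T` are dominated by some `τ |g j|` with `j ∈ T`, then the
inner product of `x` and `g` off `T` is bounded below. -/
lemma neg_sum_compl_mul_le {ι : Type*} [Fintype ι] [DecidableEq ι] {x g : ι → ℝ} {T : Finset ι}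
    {τ c : ℝ} (hτ : 0 < τ) {j : ι} (hj : j ∈ T)
    (hdom : ∀ i ∉ T, |x i - τ * g i| ≤ |τ * g j|) (hc : ∑ i ∈ T, g i ^ 2 ≤ c) :
    -∑ i ∈ Tᶜ, g i * x i ≤
      Fintype.card ι * τ * c / 2 - (∑ i ∈ Tᶜ, x i ^ 2) / (2 * τ) := by
  have hgj : g j ^ 2 ≤ c :=
    (Finset.single_le_sum (f := fun i => g i ^ 2) (fun i _ => sq_nonneg _) hj).trans hc
  have hc0 : 0 ≤ c := (sq_nonneg _).trans hgj
  have hterm : ∀ i ∈ Tᶜ, x i ^ 2 - 2 * τ * (g i * x i) ≤ τ ^ 2 * c := by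
    intro i hi
    have hsq := sq_le_sq.2 (hdom i (Finset.mem_compl.1 hi))
    nlinarith [sq_nonneg (τ * g i), mul_le_mul_of_nonneg_left hgj (sq_nonneg τ)]
  have hsum := Finset.sum_le_card_nsmul _ _ _ hterm
  rw [Finset.sum_sub_distrib, ← Finset.mul_sum, nsmul_eq_mul] at hsum
  have hcard : ((Tᶜ.card : ℕ) : ℝ) ≤ Fintype.card ι := by
    exact_mod_cast Finset.card_le_univ _
  have hmul := mul_le_mul_of_nonneg_right hcard (show 0 ≤ τ ^ 2 * c by positivity)
  rw [← mul_le_mul_iff_right₀ (show 0 < 2 * τ by positivity), mul_sub,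
    mul_div_cancel₀ _ (show 2 * τ ≠ 0 by positivity)]
  linarith

/-- the Newton-direction case of Lemma 3.3: the Armijo line-search
condition holds for every step size `α ∈ (0, ᾱ]` (given the stated bound on τ). -/
theorem armijo_condition_holds {n : ℕ}
    (f : EuclideanSpace ℝ (Fin n) → ℝ) (hf : ContDiff ℝ 1 f)
    (L σ δ τ lam : ℝ) (hL : 0 < L)
    (hsmooth : ∀ x z : EuclideanSpace ℝ (Fin n),
      f z ≤ f x + ⟪gradient f x, z - x⟫ + L / 2 * ‖z - x‖ ^ 2)
    (hσ : σ ∈ Set.Ioo (0 : ℝ) (1 / 2))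
    (hδ : δ ∈ Set.Ioc (0 : ℝ) (min 1 (2 * L)))
    (hτ : 0 < τ) (hlam : 0 < lam)
    (x : EuclideanSpace ℝ (Fin n))
    (T' : Finset (Fin n)) (hsupp : ∀ i, x i ≠ 0 → i ∈ T')
    (T : Finset (Fin n))
    (hT : T = Finset.univ.filter fun i =>
      Real.sqrt (2 * τ * lam) ≤ |x i - τ * gradient f x i|)
    (hS : (T \ T').Nonempty)
    (d : EuclideanSpace ℝ (Fin n)) (hd : ∀ i ∉ T, d i = -x i)
    (hcond : ∑ i ∈ T, gradient f x i * d i ≤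
        -δ * ∑ i, d i ^ 2 + 1 / (4 * τ) * ∑ i ∈ Tᶜ, x i ^ 2)
    (hbound : Real.sqrt (∑ i ∈ T, gradient f x i ^ 2) ≤
        L * Real.sqrt (∑ i, d i ^ 2))
    (abar : ℝ)
    (habar : abar = min (min ((1 - 2 * σ) / (L / δ - σ)) (2 * (1 - σ) * δ / L)) 1) :
    ∀ α : ℝ, 0 < α → α ≤ abar →
      τ ≤ min (min (α * δ / (n * L ^ 2)) (α / n)) (1 / (4 * L)) →
      ∀ xα : EuclideanSpace ℝ (Fin n),
        (∀ i, xα i = if i ∈ T then x i + α * d i else 0) →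
        f xα ≤ f x + σ * α * ∑ i, gradient f x i * d i := by
  intro α hα0 hα hτα xα hxα
  obtain ⟨hσ0, hσ1⟩ := hσ
  obtain ⟨hδ0, hδ1⟩ := hδ
  have hδL : δ ≤ 2 * L := hδ1.trans (min_le_right _ _)
  obtain ⟨j, hj⟩ := hS
  obtain ⟨hjT, hjT'⟩ := Finset.mem_sdiff.1 hj
  have hxj : x j = 0 := by_contra fun h => hjT' (hsupp j h)
  have hn : (0 : ℝ) < n := by exact_mod_cast j.pos
  have hα1 : α ≤ 1 := hα.trans (habar.trans_le (min_le_right _ _))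
  have hα2 : α ≤ (1 - 2 * σ) / (L / δ - σ) :=
    hα.trans (habar.trans_le ((min_le_left _ _).trans (min_le_left _ _)))
  have hτ1 : τ ≤ α * δ / (n * L ^ 2) := hτα.trans ((min_le_left _ _).trans (min_le_left _ _))
  have hτ2 : τ ≤ 1 / (4 * L) := hτα.trans (min_le_right _ _)
  set g := gradient f x with hg
  have hB0 : 0 ≤ ∑ i ∈ Tᶜ, x i ^ 2 := Finset.sum_nonneg fun i _ => sq_nonneg _
  have hDT0 : 0 ≤ ∑ i ∈ T, d i ^ 2 := Finset.sum_nonneg fun i _ => sq_nonneg _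
  have hD : ∑ i, d i ^ 2 = ∑ i ∈ T, d i ^ 2 + ∑ i ∈ Tᶜ, x i ^ 2 := by
    rw [← Finset.sum_add_sum_compl T]
    congr 1
    refine Finset.sum_congr rfl fun i hi => ?_
    rw [hd i (Finset.mem_compl.1 hi), neg_sq]
  have hgd : ∑ i, g i * d i = ∑ i ∈ T, g i * d i - ∑ i ∈ Tᶜ, g i * x i := by
    rw [← Finset.sum_add_sum_compl T, sub_eq_add_neg, ← Finset.sum_neg_distrib]
    congr 1
    refine Finset.sum_congr rfl fun i hi => ?_
    rw [hd i (Finset.mem_compl.1 hi), mul_neg]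
  have hinner : ⟪g, xα - x⟫ = α * ∑ i ∈ T, g i * d i - ∑ i ∈ Tᶜ, g i * x i := by
    rw [PiLp.inner_apply, ← Finset.sum_add_sum_compl T, sub_eq_add_neg (α * _),
      ← Finset.sum_neg_distrib, Finset.mul_sum]
    congr 1 <;> refine Finset.sum_congr rfl fun i hi => ?_
    · simp [hxα, hi]
      ring
    · simp [hxα, Finset.mem_compl.1 hi]
      ring
  have hnorm : ‖xα - x‖ ^ 2 = α ^ 2 * ∑ i ∈ T, d i ^ 2 + ∑ i ∈ Tᶜ, x i ^ 2 := by
    rw [EuclideanSpace.real_norm_sq_eq, ← Finset.sum_add_sum_compl T, Finset.mul_sum]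
    congr 1 <;> refine Finset.sum_congr rfl fun i hi => ?_
    · simp [hxα, hi, mul_pow]
    · simp [hxα, Finset.mem_compl.1 hi]
  have hgT : ∑ i ∈ T, g i ^ 2 ≤ L ^ 2 * ∑ i, d i ^ 2 := by
    have h := (Real.sqrt_le_left (by positivity)).1 hbound
    rwa [mul_pow, Real.sq_sqrt (by positivity)] at h
  have hdom : ∀ i ∉ T, |x i - τ * g i| ≤ |τ * g j| := by
    intro i hi
    have hi' : |x i - τ * g i| < √(2 * τ * lam) := by simpa [hT] using hi
    have hj' : √(2 * τ * lam) ≤ |x j - τ * g j| := by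
      rw [hT] at hjT
      exact (Finset.mem_filter.1 hjT).2
    rw [hxj, zero_sub, abs_neg] at hj'
    exact hi'.le.trans hj'
  have hG := neg_sum_compl_mul_le (x := x) (g := g) hτ hjT hdom hgT
  rw [Fintype.card_fin] at hG
  have hτ1' : τ * (n * L ^ 2) ≤ α * δ := (le_div_iff₀ (by positivity)).1 hτ1
  have hG' : -∑ i ∈ Tᶜ, g i * x i ≤
      α * δ / 2 * ∑ i, d i ^ 2 - (∑ i ∈ Tᶜ, x i ^ 2) / (2 * τ) := by
    have := mul_le_mul_of_nonneg_right hτ1' (hD ▸ add_nonneg hDT0 hB0 : 0 ≤ ∑ i, d i ^ 2)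
    linarith
  have hLτ : L * τ ≤ 1 / 4 := by
    have := (le_div_iff₀ (by positivity)).1 hτ2
    linarith
  have hαδ : α * (L - σ * δ) ≤ δ * (1 - 2 * σ) := by
    have hpos : 0 < L / δ - σ := by
      have : 1 / 2 ≤ L / δ := (le_div_iff₀ hδ0).2 (by linarith)
      linarith
    have h := mul_le_mul_of_nonneg_left ((le_div_iff₀ hpos).1 hα2) hδ0.le
    rwa [show δ * (α * (L / δ - σ)) = α * (L - σ * δ) by field_simp] at h
  have hscalar := armijo_scalar_inequality hσ0 hσ1 hτ hα0 hα1 hB0 hDT0 hD hLτ hαδ hcond hG'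
  have hdescent := hsmooth x xα
  rw [← hg, hinner, hnorm] at hdescent
  rw [hgd]
  linarith
end

section
/- Let f: ℝⁿ → ℝ be continuously differentiable, λ > 0, and let x* ∈ ℝⁿ with x* ≠ 0, T* = supp(x*), and ∇_i f(x*) = 0 for all i ∈ T*. Let ε* = min{ λ/(2‖∇_{T̄*} f(x*)‖), min_{i∈T*} |x*_i| } (interpreted as min_{i∈T*} |x*_i| when ∇_{T̄*} f(x*) = 0), and suppose f satisfies the local strong convexity inequality f(x) ≥ f(x*) + ⟨∇f(x*), x − x*⟩ + (ℓ*/2)‖x − x*‖² with some ℓ* > 0 for all x with ‖x − x*‖ < ε*. Then for every x with 0 < ‖x − x*‖ < ε*, one has f(x) + λ‖x‖₀ > f(x*) + λ‖x*‖₀; that is, x* is a strict, isolated local minimizer of f + λ‖·‖₀. -/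
open scoped RealInnerProductSpace

/-- A vector vanishing on `T` has Euclidean norm determined by its entries off `T`. -/
theorem EuclideanSpace.norm_eq_sqrt_sum_compl {ι : Type*} [Fintype ι] [DecidableEq ι]
    (g : EuclideanSpace ℝ ι) (T : Finset ι) (hg : ∀ i ∈ T, g i = 0) :
    ‖g‖ = Real.sqrt (∑ i ∈ Tᶜ, g i ^ 2) := by
  rw [EuclideanSpace.norm_eq, ← Finset.sum_add_sum_compl T,
    Finset.sum_eq_zero (s := T) fun i hi => by simp [hg i hi]]
  simp

/-- under local strong convexity, a nonzero point whose gradient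
vanishes on its support is a strict, isolated local minimizer of `f + λ‖·‖₀`
(key claim in part 1) of Theorem 3.4). -/
theorem strict_isolated_local_minimizer {n : ℕ}
    (f : EuclideanSpace ℝ (Fin n) → ℝ) (hf : ContDiff ℝ 1 f)
    (lam : ℝ) (hlam : 0 < lam)
    (xs : EuclideanSpace ℝ (Fin n)) (hxs : xs ≠ 0)
    (Tstar : Finset (Fin n))
    (hTstar : Tstar = Finset.univ.filter fun i => xs i ≠ 0)
    (hgrad : ∀ i ∈ Tstar, gradient f xs i = 0)
    (m ε ℓs : ℝ)
    (hm : m = Tstar.inf'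
      (by
        rw [hTstar, Finset.filter_nonempty_iff]
        by_contra hc
        push_neg at hc
        exact hxs (by ext i; simpa using hc i (Finset.mem_univ i)))
      (fun i => |xs i|))
    (hε0 : (∀ i ∉ Tstar, gradient f xs i = 0) → ε = m)
    (hε1 : ¬ (∀ i ∉ Tstar, gradient f xs i = 0) →
      ε = min (lam / (2 * Real.sqrt (∑ i ∈ Tstarᶜ, gradient f xs i ^ 2))) m)
    (hℓ : 0 < ℓs)
    (hconv : ∀ x : EuclideanSpace ℝ (Fin n), ‖x - xs‖ < ε →
      f xs + ⟪gradient f xs, x - xs⟫ + ℓs / 2 * ‖x - xs‖ ^ 2 ≤ f x) :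
    ∀ x : EuclideanSpace ℝ (Fin n), 0 < ‖x - xs‖ → ‖x - xs‖ < ε →
      f xs + lam * (norm0 xs : ℝ) < f x + lam * (norm0 x : ℝ) := by
  intro x hx0 hxε
  have hεm : ε ≤ m := by
    by_cases h : ∀ i ∉ Tstar, gradient f xs i = 0
    · exact (hε0 h).le
    · exact (hε1 h).trans_le (min_le_right _ _)
  have hsub : ∀ i, xs i ≠ 0 → x i ≠ 0 := by
    intro i hi hxi
    have hmi : m ≤ |xs i| := by
      rw [hm]
      exact Finset.inf'_le _ (by simp [hTstar, hi])
    have hle := PiLp.norm_apply_le (x - xs) i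
    simp only [PiLp.sub_apply, hxi, zero_sub, norm_neg, Real.norm_eq_abs] at hle
    linarith
  have hsupp : (Finset.univ.filter fun i => xs i ≠ 0) ⊆ Finset.univ.filter fun i => x i ≠ 0 :=
    Finset.monotone_filter_right _ fun i _ => hsub i
  have hstrong := hconv x hxε
  have hpos : 0 < ℓs / 2 * ‖x - xs‖ ^ 2 := by positivity
  rcases hsupp.eq_or_ssubset with heq | hss
  · have hinner : ⟪gradient f xs, x - xs⟫ = 0 := by
      rw [PiLp.inner_apply]
      refine Finset.sum_eq_zero fun i _ => ?_
      by_cases hi : xs i = 0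
      · have hxi : x i = 0 := by
          have := Finset.ext_iff.mp heq i
          simpa [hi] using this
        simp [hi, hxi]
      · simp [hgrad i (by simp [hTstar, hi])]
    have hcard : norm0 xs = norm0 x := congrArg Finset.card heq
    rw [hcard]
    linarith
  · have hlt : norm0 xs < norm0 x := Finset.card_lt_card hss
    have hcard : (norm0 xs : ℝ) + 1 ≤ norm0 x := by exact_mod_cast hlt
    have hbound : ‖gradient f xs‖ * ‖x - xs‖ ≤ lam / 2 := by
      by_cases h : ∀ i ∉ Tstar, gradient f xs i = 0
      · have hzero : gradient f xs = 0 := by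
          ext i
          by_cases hi : i ∈ Tstar
          · exact hgrad i hi
          · exact h i hi
        rw [hzero, norm_zero, zero_mul]
        positivity
      · have hgpos : 0 < ‖gradient f xs‖ := by
          refine norm_pos_iff.mpr fun hzero => h fun i _ => ?_
          simp [hzero]
        have hlt := hxε.trans_le ((hε1 h).trans_le (min_le_left _ _))
        rw [← EuclideanSpace.norm_eq_sqrt_sum_compl _ _ hgrad, lt_div_iff₀ (by positivity)] at hlt
        linarith
    have hcs := neg_le_of_abs_le (abs_real_inner_le_norm (gradient f xs) (x - xs))
    have hmul := mul_le_mul_of_nonneg_left hcard hlam.le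
    linarith
end

section
/- Let f: ℝⁿ → ℝ be twice continuously differentiable, let T ⊆ {1,…,n}, and let x, x* ∈ ℝⁿ satisfy x*_i = 0 for all i ∉ T and ∇_i f(x*) = 0 for all i ∈ T. Suppose M > 0 and ℓ > 0 are such that ‖∇²f(u) − ∇²f(v)‖₂ ≤ M‖u − v‖ for all u, v on the segment joining x* and x, and the submatrix H = ∇²_{T,T} f(x) satisfies ⟨v, Hv⟩ ≥ ℓ‖v‖² for all v ∈ ℝ^{|T|}. If d_T solves the Newton equation H d_T = ∇²_{T,T̄} f(x) x_{T̄} − ∇_T f(x), then ‖x_T + d_T − x*_T‖ ≤ (M/(2ℓ)) ‖x − x*‖². -/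
open scoped RealInnerProductSpace

theorem hess_apply_eq_fderiv_fderiv {n : ℕ} (f : EuclideanSpace ℝ (Fin n) → ℝ)
    (u : EuclideanSpace ℝ (Fin n)) (i j : Fin n) :
    hess f u i j =
      fderiv ℝ (fderiv ℝ f) u (EuclideanSpace.single i 1) (EuclideanSpace.single j 1) := by
  simp [hess, iteratedFDeriv_two_apply]

theorem EuclideanSpace.eq_sum_smul_single {n : ℕ} (w : EuclideanSpace ℝ (Fin n)) :
    w = ∑ i, w i • EuclideanSpace.single i (1 : ℝ) := by
  ext k
  simp [Finset.sum_apply, Pi.single_apply]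

/-- The second derivative as a bilinear form in the entries of the Hessian matrix. -/
theorem fderiv_fderiv_apply_eq_sum_hess {n : ℕ} (f : EuclideanSpace ℝ (Fin n) → ℝ)
    (u w e : EuclideanSpace ℝ (Fin n)) :
    fderiv ℝ (fderiv ℝ f) u w e = ∑ i, w i * ∑ j, hess f u i j * e j := by
  conv_lhs => rw [EuclideanSpace.eq_sum_smul_single w, EuclideanSpace.eq_sum_smul_single e]
  simp only [map_sum, map_smul, _root_.sum_apply, _root_.smul_apply,
    smul_eq_mul, hess_apply_eq_fderiv_fderiv, Finset.mul_sum]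
  rw [Finset.sum_comm]
  refine Finset.sum_congr rfl fun i _ => Finset.sum_congr rfl fun j _ => ?_
  ring

theorem fderiv_apply_eq_sum_gradient {n : ℕ} (f : EuclideanSpace ℝ (Fin n) → ℝ)
    (u w : EuclideanSpace ℝ (Fin n)) :
    fderiv ℝ f u w = ∑ i, w i * gradient f u i := by
  have h : fderiv ℝ f u w = inner ℝ (gradient f u) w := by
    simp [gradient]
  rw [h, PiLp.inner_apply]
  simp

/-- First-order Taylor estimate for the derivative of `f` paired with a fixed vector `w`, when the
second derivative is Lipschitz along the segment. -/
theorem fderiv_fderiv_sub_fderiv_sub_le {E : Type*} [NormedAddCommGroup E] [NormedSpace ℝ E]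
    {f : E → ℝ} (hf : ContDiff ℝ 2 f) (a e w : E) (C : ℝ)
    (hC : ∀ t ∈ Set.Icc (0 : ℝ) 1,
      fderiv ℝ (fderiv ℝ f) (a + e) w e - fderiv ℝ (fderiv ℝ f) (a + t • e) w e ≤ C * (1 - t)) :
    fderiv ℝ (fderiv ℝ f) (a + e) w e - (fderiv ℝ f (a + e) w - fderiv ℝ f a w) ≤ C / 2 := by
  have hf' : Differentiable ℝ (fderiv ℝ f) :=
    (hf.fderiv_right (m := 1) (by norm_num)).differentiable (by norm_num)
  have hsymm (u : E) : fderiv ℝ (fderiv ℝ f) u e w = fderiv ℝ (fderiv ℝ f) u w e :=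
    (hf.contDiffAt.isSymmSndFDerivAt (by simp)) e w
  set K := fderiv ℝ (fderiv ℝ f) (a + e) w e with hK
  have hderiv (t : ℝ) : HasDerivAt
      (fun t : ℝ => t * K - fderiv ℝ f (a + t • e) w + C / 2 * (1 - t) ^ 2)
      (K - fderiv ℝ (fderiv ℝ f) (a + t • e) w e - C * (1 - t)) t := by
    have hline : HasDerivAt (fun t : ℝ => a + t • e) e t := by
      simpa using ((hasDerivAt_id t).smul_const e).const_add a
    have h₁ : HasDerivAt (fun t : ℝ => fderiv ℝ f (a + t • e) w)
        (fderiv ℝ (fderiv ℝ f) (a + t • e) e w) t :=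
      (ContinuousLinearMap.apply ℝ ℝ w).hasFDerivAt.comp_hasDerivAt t
        ((hf' (a + t • e)).hasFDerivAt.comp_hasDerivAt t hline)
    have h₂ := (((hasDerivAt_id t).const_sub 1).pow 2).const_mul (C / 2)
    have h₃ := (((hasDerivAt_id t).mul_const K).sub h₁).add h₂
    refine h₃.congr_deriv ?_
    simp only [hsymm, id]
    push_cast
    ring
  have hanti : AntitoneOn (fun t : ℝ => t * K - fderiv ℝ f (a + t • e) w + C / 2 * (1 - t) ^ 2)
      (Set.Icc 0 1) := by
    refine antitoneOn_of_deriv_nonpos (convex_Icc 0 1)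
      (fun t _ => (hderiv t).continuousAt.continuousWithinAt)
      (fun t _ => (hderiv t).differentiableAt.differentiableWithinAt) fun t ht => ?_
    rw [(hderiv t).deriv]
    linarith [hC t (interior_subset ht)]
  have h := hanti (Set.left_mem_Icc.2 zero_le_one) (Set.right_mem_Icc.2 zero_le_one) zero_le_one
  simp only [one_smul, zero_smul, add_zero] at h
  linarith

/-- the per-step Newton estimate (inequality (3.45)) at the core of
the quadratic convergence rate of the NL0R algorithm. The Lipschitz bound on the
spectral norm `‖∇²f(u) − ∇²f(v)‖₂ ≤ M‖u − v‖` is expressed by the equivalent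
operator inequality. -/
theorem newton_step_quadratic_estimate {n : ℕ}
    (f : EuclideanSpace ℝ (Fin n) → ℝ) (hf : ContDiff ℝ 2 f)
    (T : Finset (Fin n)) (x xs d : EuclideanSpace ℝ (Fin n))
    (hxs : ∀ i ∉ T, xs i = 0)
    (hgrad : ∀ i ∈ T, gradient f xs i = 0)
    (M ℓ : ℝ) (hM : 0 < M) (hℓ : 0 < ℓ)
    (hlip : ∀ u ∈ segment ℝ xs x, ∀ v ∈ segment ℝ xs x, ∀ w : Fin n → ℝ,
      Real.sqrt (∑ i, (∑ j, (hess f u i j - hess f v i j) * w j) ^ 2) ≤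
        M * ‖u - v‖ * Real.sqrt (∑ i, w i ^ 2))
    (hpos : ∀ v : Fin n → ℝ,
      ℓ * ∑ i ∈ T, v i ^ 2 ≤ ∑ i ∈ T, v i * ∑ j ∈ T, hess f x i j * v j)
    (hnewton : ∀ i ∈ T, ∑ j ∈ T, hess f x i j * d j =
        ∑ j ∈ Tᶜ, hess f x i j * x j - gradient f x i) :
    Real.sqrt (∑ i ∈ T, (x i + d i - xs i) ^ 2) ≤
      M / (2 * ℓ) * ‖x - xs‖ ^ 2 := by
  set e : EuclideanSpace ℝ (Fin n) := x - xs with he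
  set w : EuclideanSpace ℝ (Fin n) :=
    WithLp.toLp 2 fun i => if i ∈ T then x i + d i - xs i else 0 with hw
  have hwT : ∀ i ∈ T, w i = x i + d i - xs i := fun i hi => by simp [hw, hi]
  have hsum (g : Fin n → ℝ) : ∑ i, w i * g i = ∑ i ∈ T, w i * g i := by
    refine (Finset.sum_subset T.subset_univ fun i _ hi => ?_).symm
    simp [hw, hi]
  have hxe : xs + e = x := by simp [he]
  have hnorm (v : EuclideanSpace ℝ (Fin n)) : Real.sqrt (∑ i, v i ^ 2) = ‖v‖ := by
    simp [EuclideanSpace.norm_eq]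
  have hwsq : ∑ i ∈ T, w i ^ 2 = ‖w‖ ^ 2 := by
    rw [EuclideanSpace.real_norm_sq_eq]
    simpa only [sq] using (hsum fun i => w i).symm
  have hgoal : Real.sqrt (∑ i ∈ T, (x i + d i - xs i) ^ 2) = ‖w‖ := by
    rw [← Real.sqrt_sq (norm_nonneg w), ← hwsq]
    exact congrArg _ (Finset.sum_congr rfl fun i hi => by rw [hwT i hi])
  have hrow : ∀ i ∈ T, ∑ j ∈ T, hess f x i j * w j =
      ∑ j, hess f x i j * e j - gradient f x i := fun i hi => by
    have h₁ : ∑ j ∈ T, hess f x i j * w j =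
        ∑ j ∈ T, hess f x i j * e j + ∑ j ∈ T, hess f x i j * d j := by
      rw [← Finset.sum_add_distrib]
      refine Finset.sum_congr rfl fun j hj => ?_
      rw [hwT j hj, he, PiLp.sub_apply]
      ring
    have h₂ : ∑ j ∈ Tᶜ, hess f x i j * x j = ∑ j ∈ Tᶜ, hess f x i j * e j := by
      refine Finset.sum_congr rfl fun j hj => ?_
      rw [he, PiLp.sub_apply, hxs j (Finset.mem_compl.1 hj), sub_zero]
    rw [h₁, hnewton i hi, h₂, ← Finset.sum_add_sum_compl T fun j => hess f x i j * e j]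
    ring
  have hlower : ℓ * ‖w‖ ^ 2 ≤
      fderiv ℝ (fderiv ℝ f) (xs + e) w e - (fderiv ℝ f (xs + e) w - fderiv ℝ f xs w) := by
    have hzero : ∑ i ∈ T, w i * gradient f xs i = 0 :=
      Finset.sum_eq_zero fun i hi => by rw [hgrad i hi, mul_zero]
    rw [hxe, fderiv_fderiv_apply_eq_sum_hess, fderiv_apply_eq_sum_gradient,
      fderiv_apply_eq_sum_gradient, hsum, hsum, hsum, hzero, sub_zero,
      ← Finset.sum_sub_distrib, ← hwsq]
    refine (hpos w).trans_eq (Finset.sum_congr rfl fun i hi => ?_)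
    rw [hrow i hi]
    ring
  have hupper := fderiv_fderiv_sub_fderiv_sub_le hf xs e w (M * ‖e‖ ^ 2 * ‖w‖) fun t ht => by
    have hmem : xs + t • e ∈ segment ℝ xs x := by
      rw [segment_eq_image']
      exact ⟨t, ht, rfl⟩
    have h := hlip x (right_mem_segment ℝ xs x) _ hmem e
    have hdist : ‖x - (xs + t • e)‖ = (1 - t) * ‖e‖ := by
      have : x - (xs + t • e) = (1 - t) • e := by
        rw [sub_smul, one_smul, he]
        abel
      rw [this, norm_smul, Real.norm_of_nonneg (by linarith [ht.2])]
    rw [hdist, hnorm e] at h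
    rw [hxe, fderiv_fderiv_apply_eq_sum_hess, fderiv_fderiv_apply_eq_sum_hess,
      ← Finset.sum_sub_distrib]
    calc ∑ i, (w i * ∑ j, hess f x i j * e j - w i * ∑ j, hess f (xs + t • e) i j * e j)
        = ∑ i, w i * ∑ j, (hess f x i j - hess f (xs + t • e) i j) * e j := by
          refine Finset.sum_congr rfl fun i _ => ?_
          rw [← mul_sub, ← Finset.sum_sub_distrib]
          simp only [sub_mul]
      _ ≤ ‖w‖ * (M * ((1 - t) * ‖e‖) * ‖e‖) := by
          refine (Real.sum_mul_le_sqrt_mul_sqrt _ _ _).trans ?_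
          rw [hnorm w]
          gcongr
      _ = M * ‖e‖ ^ 2 * ‖w‖ * (1 - t) := by ring
  rw [hgoal, div_mul_eq_mul_div, le_div_iff₀ (by positivity)]
  rcases (norm_nonneg w).eq_or_lt with h0 | h0
  · rw [← h0, zero_mul]
    positivity
  · refine le_of_mul_le_mul_left ?_ h0
    linarith [hlower.trans hupper]
end
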